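/- A 2d-dimensional multisequence (c_{m,n})_{m,n∈ℕ^d} of complex numbers is a complex moment multisequence (i.e., there exists a positive Borel measure ν on ℂ^d with c_{m,n} = ∫_{ℂ^d} z^m conj(z)^n dν(z) for all m, n ∈ ℕ^d) if and only if there exists a family {μ_ξ}_{ξ∈Ξ} of positive Borel measures on ℂ^d such that: (1) c_{m,n}^ξ = ∫_{ℂ^d} z^m conj(z)^n dμ_ξ(z) for all m, n ∈ N_1 and all ξ ∈ Ξ, and (2) μ_0 = 0 and μ_{ξ+η} + μ_{ξ−η} − 2μ_η ≥ 0 for all ξ, η ∈ Ξ. -/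

import Mathlib

open MeasureTheory Finsupp Complex

noncomputable section

/-- `z^m conj(z)^n` for `z ∈ ℂ^d`, `m, n ∈ ℕ^d`. -/
def cmom {d : ℕ} (z : Fin d → ℂ) (m n : Fin d → ℕ) : ℂ :=
  (∏ i, z i ^ m i) * ∏ i, (starRingEnd ℂ) (z i) ^ n i

/-- `c_{m,n}^ξ := ∑_{k,l} c_{m+k,n+l} ξ_k conj(ξ_l)`. -/
def cXi {d : ℕ} (c : (Fin d → ℕ) → (Fin d → ℕ) → ℂ) (ξ : (Fin d → ℕ) →₀ ℂ)
    (m n : Fin d → ℕ) : ℂ :=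
  ∑ k ∈ ξ.support, ∑ l ∈ ξ.support, c (m + k) (n + l) * ξ k * (starRingEnd ℂ) (ξ l)

/-- Every additive commutative group carries a translation-invariant mean. -/
theorem exists_invariant_mean (G : Type*) [AddCommGroup G] :
    ∃ M : (G → ℝ) →ₗ[ℝ] ℝ,
      (∀ (f : G → ℝ) (C K : ℝ), (∀ x, |f x| ≤ K) → (∀ x, f x ≤ C) → M f ≤ C) ∧
      ∀ (f : G → ℝ) (K : ℝ) (g : G), (∀ x, |f x| ≤ K) → M (fun x => f (x + g)) = M f := by
  let V : Submodule ℝ (G → ℝ) :=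
    { carrier := {f | ∃ K : ℝ, ∀ x, |f x| ≤ K}
      add_mem' := by
        rintro a b ⟨K, hK⟩ ⟨L, hL⟩
        exact ⟨K + L, fun x => (abs_add_le _ _).trans (add_le_add (hK x) (hL x))⟩
      zero_mem' := ⟨0, fun x => by simp⟩
      smul_mem' := by
        rintro c a ⟨K, hK⟩
        refine ⟨|c| * K, fun x => ?_⟩
        simpa [abs_mul] using mul_le_mul_of_nonneg_left (hK x) (abs_nonneg c) }
  let S : V → Set ℝ := fun f => {c | ∃ (ι : Type) (_ : Fintype ι) (_ : Nonempty ι) (g : ι → G),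
    ∀ x, ∑ i, f.1 (x + g i) ≤ c * Fintype.card ι}
  have S_single : ∀ (f : V) (C : ℝ), (∀ x, f.1 x ≤ C) → C ∈ S f := by
    intro f C hC
    exact ⟨Unit, inferInstance, inferInstance, fun _ => 0, fun x => by simpa using hC x⟩
  have S_ne : ∀ f : V, (S f).Nonempty := by
    rintro f
    obtain ⟨K, hK⟩ := f.2
    exact ⟨K, S_single f K fun x => (le_abs_self _).trans (hK x)⟩
  have S_lower : ∀ (f : V) (K : ℝ), (∀ x, |f.1 x| ≤ K) → ∀ c ∈ S f, -K ≤ c := by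
    rintro f K hK c ⟨ι, _, _, g, hg⟩
    have h1 : ∑ i : ι, (-K) ≤ ∑ i, f.1 (0 + g i) :=
      Finset.sum_le_sum fun i _ => (abs_le.1 (hK _)).1
    have h2 := h1.trans (hg 0)
    rw [Finset.sum_const, Finset.card_univ, nsmul_eq_mul, mul_comm] at h2
    exact le_of_mul_le_mul_right h2 (by exact_mod_cast Fintype.card_pos)
  have S_bdd : ∀ f : V, BddBelow (S f) := by
    intro f
    obtain ⟨K, hK⟩ := f.2
    exact ⟨-K, S_lower f K hK⟩
  have S_add : ∀ (f h : V) (a b : ℝ), a ∈ S f → b ∈ S h → a + b ∈ S (f + h) := by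
    rintro f h a b ⟨ι, _, _, g, hg⟩ ⟨κ, _, _, g', hg'⟩
    refine ⟨ι × κ, inferInstance, inferInstance, fun p => g p.1 + g' p.2, fun x => ?_⟩
    have e1 : ∑ p : ι × κ, f.1 (x + (g p.1 + g' p.2)) ≤ a * Fintype.card ι * Fintype.card κ := by
      rw [Fintype.sum_prod_type_right]
      calc _ ≤ ∑ j : κ, a * Fintype.card ι := Finset.sum_le_sum fun j _ => by
            have := hg (x + g' j)
            refine le_of_eq_of_le (Finset.sum_congr rfl fun i _ => ?_) this
            rw [add_comm (g i), add_assoc]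
        _ = _ := by simp [mul_comm]
    have e2 : ∑ p : ι × κ, h.1 (x + (g p.1 + g' p.2)) ≤ b * Fintype.card κ * Fintype.card ι := by
      rw [Fintype.sum_prod_type]
      calc _ ≤ ∑ j : ι, b * Fintype.card κ := Finset.sum_le_sum fun j _ => by
            have := hg' (x + g j)
            refine le_of_eq_of_le (Finset.sum_congr rfl fun i _ => ?_) this
            rw [add_assoc]
        _ = _ := by simp [mul_comm]
    simp only [Submodule.coe_add, Pi.add_apply, Finset.sum_add_distrib, Fintype.card_prod,
      Nat.cast_mul]
    linarith
  have S_smul : ∀ (f : V) (t a : ℝ), 0 < t → a ∈ S f → t * a ∈ S (t • f) := by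
    rintro f t a ht ⟨ι, _, _, g, hg⟩
    refine ⟨ι, inferInstance, inferInstance, g, fun x => ?_⟩
    have := mul_le_mul_of_nonneg_left (hg x) ht.le
    simpa [Finset.mul_sum, mul_assoc] using this
  have p_smul_le : ∀ t : ℝ, 0 < t → ∀ f : V, sInf (S (t • f)) ≤ t * sInf (S f) := by
    intro t ht f
    rw [← div_le_iff₀' ht]
    refine le_csInf (S_ne f) fun a ha => ?_
    rw [div_le_iff₀' ht]
    exact csInf_le (S_bdd _) (S_smul f t a ht ha)
  obtain ⟨L, -, hL⟩ := exists_extension_of_le_sublinear (⊥ : V →ₗ.[ℝ] ℝ) (fun f => sInf (S f))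
    (by
      intro t ht f
      refine le_antisymm (p_smul_le t ht f) ?_
      have := p_smul_le t⁻¹ (inv_pos.2 ht) (t • f)
      rw [inv_smul_smul₀ ht.ne'] at this
      rwa [← div_eq_inv_mul, le_div_iff₀' ht] at this)
    (by
      intro f h
      rw [← sub_le_iff_le_add]
      refine le_csInf (S_ne f) fun a ha => ?_
      rw [sub_le_comm]
      refine le_csInf (S_ne h) fun b hb => ?_
      rw [sub_le_iff_le_add']
      exact csInf_le (S_bdd _) (S_add f h a b ha hb))
    (by
      rintro ⟨x, hx⟩
      have hx0 : x = 0 := (Submodule.mem_bot ℝ).1 hx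
      subst hx0
      have : (⊥ : V →ₗ.[ℝ] ℝ) ⟨0, hx⟩ = 0 := LinearPMap.map_zero _
      rw [this]
      exact le_csInf (S_ne _) fun c hc => by simpa using S_lower 0 0 (by simp) c hc)
  obtain ⟨M, hM⟩ := LinearMap.exists_extend L
  have hML : ∀ f : V, M f.1 = L f := fun f => by rw [← hM]; rfl
  have inv_le : ∀ (f : G → ℝ) (K : ℝ) (g : G), (∀ x, |f x| ≤ K) →
      M f - M (fun x => f (x + g)) ≤ 0 := by
    intro f K g hK
    let u : V := ⟨f, K, hK⟩
    let v : V := ⟨fun x => f (x + g), K, fun x => hK _⟩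
    have key : ∀ n : ℕ, 0 < n → (2 * K) / n ∈ S (u - v) := by
      intro n hn
      have : Nonempty (Fin n) := ⟨⟨0, hn⟩⟩
      refine ⟨Fin n, inferInstance, inferInstance, fun i => (i : ℕ) • g, fun x => ?_⟩
      have e : ∑ i : Fin n, (u - v).1 (x + (i : ℕ) • g) = f x - f (x + n • g) := by
        have e0 : ∀ i : Fin n, (u - v).1 (x + (i : ℕ) • g)
            = f (x + (i : ℕ) • g) - f (x + ((i : ℕ) + 1) • g) := by
          intro i
          simp [u, v, add_smul, add_assoc]
        rw [Finset.sum_congr rfl fun i _ => e0 i,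
          Fin.sum_univ_eq_sum_range (fun i => f (x + i • g) - f (x + (i + 1) • g)) n,
          Finset.sum_range_sub']
        simp
      have hn' : (n : ℝ) ≠ 0 := by positivity
      rw [e, Fintype.card_fin, div_mul_cancel₀ _ hn']
      have h1 := abs_le.1 (hK x)
      have h2 := abs_le.1 (hK (x + n • g))
      linarith
    have h1 : M f - M (fun x => f (x + g)) = L (u - v) := by
      rw [map_sub, ← hML, ← hML]
    rw [h1]
    refine ge_of_tendsto (tendsto_const_div_atTop_nhds_zero_nat (2 * K)) ?_
    filter_upwards [Filter.eventually_gt_atTop 0] with n hn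
    exact (hL _).trans (csInf_le (S_bdd _) (key n hn))
  refine ⟨M, fun f C K hK hC => ?_, fun f K g hK => ?_⟩
  · have := (hL ⟨f, K, hK⟩).trans (csInf_le (S_bdd _) (S_single ⟨f, K, hK⟩ C hC))
    rwa [← hML] at this
  · have h1 := inv_le f K g hK
    have h2 := inv_le (-f) K g (fun x => by simpa using hK x)
    have h3 : M (fun x => (-f) (x + g)) = - M (fun x => f (x + g)) := by
      rw [← map_neg]; rfl
    rw [h3, map_neg] at h2
    linarith

section JordanVonNeumann

variable {E : Type*} [AddCommGroup E]

/-- The real polarization of a function on an abelian group. -/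
def polarRe (q : E → ℝ) (x y : E) : ℝ := (q (x + y) - q (x - y)) / 4

/-- The complex polarization of a function on a complex vector space. -/
def polar [Module ℂ E] (q : E → ℝ) (x y : E) : ℂ :=
  polarRe q x y + polarRe q x (I • y) * I

variable {q : E → ℝ} (hq : ∀ x y, q (x + y) + q (x - y) = 2 * q x + 2 * q y)
include hq

theorem parallelogram_zero : q 0 = 0 := by
  have := hq 0 0
  simp at this
  linarith

theorem parallelogram_neg (x : E) : q (-x) = q x := by
  have := hq 0 x
  simp [parallelogram_zero hq] at this
  linarith

theorem parallelogram_two (x : E) : q (x + x) = 4 * q x := by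
  have := hq x x
  simp [parallelogram_zero hq] at this
  linarith

theorem polarRe_comm (x y : E) : polarRe q x y = polarRe q y x := by
  rw [polarRe, polarRe, add_comm x y, ← neg_sub y x, parallelogram_neg hq]

theorem polarRe_self (x : E) : polarRe q x x = q x := by
  simp [polarRe, parallelogram_zero hq, parallelogram_two hq]

theorem polarRe_neg_left (x y : E) : polarRe q (-x) y = - polarRe q x y := by
  have h1 : -x + y = -(x - y) := by abel
  have h2 : -x - y = -(x + y) := by abel
  rw [polarRe, polarRe, h1, h2, parallelogram_neg hq, parallelogram_neg hq]
  ring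

theorem polarRe_zero_left (y : E) : polarRe q 0 y = 0 := by
  have := polarRe_neg_left hq 0 y
  rw [neg_zero] at this
  linarith

theorem polarRe_add_left (x y b : E) :
    polarRe q (x + y) b = polarRe q x b + polarRe q y b := by
  have key : ∀ a a' : E, polarRe q (a + a') b + polarRe q (a - a') b = 2 * polarRe q a b := by
    intro a a'
    have h1 := hq (a + b) a'
    have h2 := hq (a - b) a'
    simp only [polarRe]
    rw [show a + a' + b = a + b + a' by abel, show a - a' + b = a + b - a' by abel,
      show a + a' - b = a - b + a' by abel, show a - a' - b = a - b - a' by abel]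
    linarith
  have two : ∀ a : E, polarRe q (a + a) b = 2 * polarRe q a b := by
    intro a
    have := key a a
    rwa [sub_self, polarRe_zero_left hq, add_zero] at this
  have h := key (x + y) (x - y)
  rw [show x + y + (x - y) = x + x by abel, show x + y - (x - y) = y + y by abel, two, two] at h
  linarith

theorem polarRe_add_right (x y b : E) :
    polarRe q b (x + y) = polarRe q b x + polarRe q b y := by
  rw [polarRe_comm hq, polarRe_add_left hq, polarRe_comm hq x, polarRe_comm hq y]

variable [Module ℂ E] (h0 : ∀ x, 0 ≤ q x)
  (hb : ∀ x : E, ∃ C : ℝ, ∀ t : ℝ, |t| ≤ 1 → q ((t : ℂ) • x) ≤ C)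
include h0 hb in
theorem polarRe_real_smul_left (t : ℝ) (x y : E) :
    polarRe q ((t : ℂ) • x) y = t * polarRe q x y := by
  let f : ℝ →+ ℝ :=
    { toFun := fun t => polarRe q ((t : ℂ) • x) y
      map_zero' := by simp [polarRe_zero_left hq]
      map_add' := fun s t => by simp [add_smul, polarRe_add_left hq] }
  have hf : Continuous f := by
    obtain ⟨C, hC⟩ := hb x
    refine f.continuous_of_isBounded_nhds_zero (s := Metric.closedBall 0 1)
      (Metric.closedBall_mem_nhds 0 one_pos) ?_
    rw [isBounded_iff_forall_norm_le]
    refine ⟨(C + q y) / 2, ?_⟩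
    rintro _ ⟨t, ht, rfl⟩
    have h1 := hC t (by simpa using ht)
    have h2 := hq ((t : ℂ) • x) y
    have h3 := h0 ((t : ℂ) • x + y)
    have h4 := h0 ((t : ℂ) • x - y)
    change |polarRe q ((t : ℂ) • x) y| ≤ _
    rw [polarRe, abs_le]
    constructor <;> linarith
  have := (f.toRealLinearMap hf).map_smul t 1
  simpa [f] using this

variable (hI : ∀ x, q (I • x) = q x)

omit hq in
include hI in
theorem polarRe_I_I (x y : E) : polarRe q (I • x) (I • y) = polarRe q x y := by
  rw [polarRe, polarRe, ← smul_add, ← smul_sub, hI, hI]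

include hI in
theorem polarRe_I_left (x y : E) : polarRe q (I • x) y = - polarRe q x (I • y) := by
  rw [← polarRe_I_I hI, smul_smul, I_mul_I, neg_one_smul, polarRe_neg_left hq]

theorem polar_add_left (x y b : E) : polar q (x + y) b = polar q x b + polar q y b := by
  simp only [polar, polarRe_add_left hq]; push_cast; ring

theorem polar_add_right (x y b : E) : polar q b (x + y) = polar q b x + polar q b y := by
  simp only [polar, smul_add, polarRe_add_right hq]; push_cast; ring

include hI in
theorem polar_conj_symm (x y : E) : (starRingEnd ℂ) (polar q x y) = polar q y x := by
  apply Complex.ext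
  · simp [polar, polarRe_comm hq x y]
  · simp [polar, polarRe_comm hq x (I • y), polarRe_I_left hq hI]

include hI in
theorem polar_self (x : E) : polar q x x = q x := by
  have h := polarRe_I_left hq hI x x
  rw [polarRe_comm hq] at h
  have : polarRe q x (I • x) = 0 := by linarith
  simp [polar, this, polarRe_self hq]

include h0 hb hI in
theorem polar_smul_left (s : ℂ) (x y : E) : polar q (s • x) y = s * polar q x y := by
  have hs : s • x = (s.re : ℂ) • x + (s.im : ℂ) • (I • x) := by
    rw [smul_smul, ← add_smul, re_add_im]
  rw [hs, polar_add_left hq]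
  simp only [polar, polarRe_real_smul_left hq h0 hb, polarRe_I_I hI, polarRe_I_left hq hI]
  apply Complex.ext
  · simp
    ring
  · simp

include h0 hb hI in
theorem polar_smul_right (s : ℂ) (x y : E) :
    polar q x (s • y) = (starRingEnd ℂ) s * polar q x y := by
  rw [← polar_conj_symm hq hI, polar_smul_left hq h0 hb hI, map_mul, polar_conj_symm hq hI]

end JordanVonNeumann

/-- The tent-shaped cutoff functions `z ↦ max 0 (1 - ‖z‖ / (n + 1))`. -/
def cutoff {X : Type*} [NormedAddCommGroup X] (n : ℕ) (z : X) : ℝ :=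
  max 0 (1 - ‖z‖ / (n + 1))

section Cutoff

variable {X : Type*} [NormedAddCommGroup X]

theorem cutoff_nonneg (n : ℕ) (z : X) : 0 ≤ cutoff n z := le_max_left _ _

theorem cutoff_le_one (n : ℕ) (z : X) : cutoff n z ≤ 1 :=
  max_le zero_le_one (sub_le_self _ (by positivity))

theorem one_sub_cutoff_le (n : ℕ) (z : X) : 1 - cutoff n z ≤ ‖z‖ / (n + 1) := by
  have := le_max_right 0 (1 - ‖z‖ / ((n : ℝ) + 1))
  rw [cutoff]
  linarith

theorem continuous_cutoff (n : ℕ) : Continuous (cutoff n : X → ℝ) := by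
  unfold cutoff
  fun_prop

theorem cutoff_mono (z : X) : Monotone fun n => cutoff n z := by
  intro m n h
  refine max_le_max le_rfl (sub_le_sub_left ?_ _)
  have : (m : ℝ) ≤ n := by exact_mod_cast h
  gcongr

theorem tendsto_cutoff (z : X) :
    Filter.Tendsto (fun n => cutoff n z) Filter.atTop (nhds 1) := by
  have h := tendsto_one_div_add_atTop_nhds_zero_nat.const_mul ‖z‖
  have h2 : Filter.Tendsto (fun n : ℕ => max 0 (1 - ‖z‖ * (1 / ((n : ℝ) + 1)))) Filter.atTop
      (nhds (max 0 (1 - ‖z‖ * 0))) := tendsto_const_nhds.max (tendsto_const_nhds.sub h)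
  simpa [cutoff, div_eq_mul_inv] using h2

theorem hasCompactSupport_cutoff [ProperSpace X] (n : ℕ) :
    HasCompactSupport (cutoff n : X → ℝ) := by
  refine HasCompactSupport.of_support_subset_isCompact
    (isCompact_closedBall (0 : X) ((n : ℝ) + 1)) fun z hz => ?_
  rw [mem_closedBall_zero_iff]
  by_contra! h
  refine hz (max_eq_left ?_)
  rw [sub_nonpos, le_div_iff₀ (by positivity)]
  linarith

end Cutoff

open scoped CompactlySupported in
/-- Averaging measures with uniformly bounded second moments by means of a mean produces a finite
measure which keeps integrals of functions of linear growth and does not increase the integrals of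
nonnegative functions of quadratic growth. -/
theorem exists_measure_of_mean {G X : Type*} [NormedAddCommGroup X] [ProperSpace X]
    [MeasurableSpace X] [BorelSpace X] (M : (G → ℝ) →ₗ[ℝ] ℝ)
    (hM : ∀ (f : G → ℝ) (C K : ℝ), (∀ x, |f x| ≤ K) → (∀ x, f x ≤ C) → M f ≤ C)
    (ρ : G → Measure X) (K : ℝ) (h_int : ∀ ξ, Integrable (fun z => 1 + ‖z‖ ^ 2) (ρ ξ))
    (hK : ∀ ξ, ∫ z, (1 + ‖z‖ ^ 2) ∂(ρ ξ) ≤ K) :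
    ∃ l : Measure X, IsFiniteMeasure l ∧
      (∀ f : X → ℝ, Continuous f → ∀ C : ℝ, (∀ z, |f z| ≤ C * (1 + ‖z‖)) →
        Integrable f l ∧ ∫ z, f z ∂l = M fun ξ => ∫ z, f z ∂(ρ ξ)) ∧
      ∀ f : X → ℝ, Continuous f → ∀ C : ℝ, (∀ z, 0 ≤ f z) → (∀ z, f z ≤ C * (1 + ‖z‖ ^ 2)) →
        Integrable f l ∧ ∫ z, f z ∂l ≤ M fun ξ => ∫ z, f z ∂(ρ ξ) := by
  have int_of : ∀ f : X → ℝ, Continuous f → ∀ C : ℝ, (∀ z, |f z| ≤ C * (1 + ‖z‖ ^ 2)) →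
      ∀ ξ, Integrable f (ρ ξ) := fun f hf C hC ξ =>
    ((h_int ξ).const_mul C).mono' hf.aestronglyMeasurable (.of_forall hC)
  have bound_of : ∀ f : X → ℝ, Continuous f → ∀ C : ℝ, 0 ≤ C →
      (∀ z, |f z| ≤ C * (1 + ‖z‖ ^ 2)) → ∀ ξ, |∫ z, f z ∂(ρ ξ)| ≤ C * K := by
    intro f hf C hC0 hC ξ
    calc |∫ z, f z ∂(ρ ξ)| ≤ ∫ z, C * (1 + ‖z‖ ^ 2) ∂(ρ ξ) :=
          norm_integral_le_of_norm_le (f := f) ((h_int ξ).const_mul C) (.of_forall hC)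
      _ = C * ∫ z, (1 + ‖z‖ ^ 2) ∂(ρ ξ) := integral_const_mul _ _
      _ ≤ _ := mul_le_mul_of_nonneg_left (hK ξ) hC0
  have abs_M : ∀ (f : G → ℝ) (C : ℝ), (∀ x, |f x| ≤ C) → |M f| ≤ C := by
    intro f C hC
    have h1 := hM f C C hC fun x => (abs_le.1 (hC x)).2
    have h2 := hM (-f) C C (by simpa using hC) fun x => by
      have := (abs_le.1 (hC x)).1
      simp only [Pi.neg_apply]; linarith
    rw [map_neg] at h2
    exact abs_le.2 ⟨by linarith, h1⟩
  have grow : ∀ f : C_c(X, ℝ), ∃ C : ℝ, 0 ≤ C ∧ ∀ z, |f z| ≤ C * (1 + ‖z‖ ^ 2) := by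
    intro f
    obtain ⟨C, hC⟩ := f.hasCompactSupport.exists_bound_of_continuous f.continuous
    have hC0 : 0 ≤ C := (norm_nonneg _).trans (hC 0)
    exact ⟨C, hC0, fun z =>
      (hC z).trans (le_mul_of_one_le_right hC0 (by nlinarith [sq_nonneg ‖z‖]))⟩
  have intc : ∀ (f : C_c(X, ℝ)) ξ, Integrable f (ρ ξ) := by
    intro f ξ
    obtain ⟨C, -, hC⟩ := grow f
    exact int_of f f.continuous C hC ξ
  let L : C_c(X, ℝ) →ₗ[ℝ] ℝ :=
    { toFun := fun f => M fun ξ => ∫ z, f z ∂(ρ ξ)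
      map_add' := fun f g => by
        rw [← map_add]
        congr 1
        funext ξ
        exact integral_add (intc f ξ) (intc g ξ)
      map_smul' := fun c f => by
        rw [RingHom.id_apply, ← map_smul]
        congr 1
        funext ξ
        exact integral_const_mul _ _ }
  have mono_T : ∀ f g : X → ℝ, Continuous f → Continuous g → ∀ C : ℝ,
      (∀ z, |f z| ≤ C * (1 + ‖z‖ ^ 2)) → (∀ z, |g z| ≤ C * (1 + ‖z‖ ^ 2)) → (∀ z, f z ≤ g z) →
      M (fun ξ => ∫ z, f z ∂(ρ ξ)) ≤ M fun ξ => ∫ z, g z ∂(ρ ξ) := by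
    intro f g hf hg C hfC hgC hfg
    have hC0 : 0 ≤ C := by simpa using (abs_nonneg _).trans (hfC 0)
    rw [← sub_nonpos, ← map_sub]
    refine hM _ 0 (C * K + C * K) (fun ξ => ?_) fun ξ => ?_
    · exact (abs_sub _ _).trans
        (add_le_add (bound_of f hf C hC0 hfC ξ) (bound_of g hg C hC0 hgC ξ))
    · simp only [Pi.sub_apply, sub_nonpos]
      exact integral_mono (int_of f hf C hfC ξ) (int_of g hg C hgC ξ) hfg
  have L_nonneg : ∀ f : C_c(X, ℝ), 0 ≤ f → 0 ≤ L f := by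
    intro f hf
    obtain ⟨C, hC0, hC⟩ := grow f
    have := mono_T (fun _ => 0) f continuous_const f.continuous C
      (fun z => by rw [abs_zero]; positivity) hC hf
    have h0 : M (fun ξ => ∫ _, (0 : ℝ) ∂(ρ ξ)) = 0 := by
      simp only [integral_zero]
      exact map_zero M
    rwa [h0] at this
  let Λ : C_c(X, ℝ) →ₚ[ℝ] ℝ := PositiveLinearMap.mk₀ L L_nonneg
  let l := RealRMK.rieszMeasure Λ
  let cut : ∀ (f : X → ℝ), Continuous f → ℕ → C_c(X, ℝ) := fun f hf n =>
    { toFun := fun z => cutoff n z * f z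
      continuous_toFun := (continuous_cutoff n).mul hf
      hasCompactSupport' := (hasCompactSupport_cutoff n).mul_right }
  have int_cut : ∀ f : X → ℝ, Continuous f → ∀ n,
      ∫ z, cutoff n z * f z ∂l = M fun ξ => ∫ z, cutoff n z * f z ∂(ρ ξ) :=
    fun f hf n => RealRMK.integral_rieszMeasure Λ (cut f hf n)
  have quadratic_growth : ∀ f : X → ℝ, Continuous f → ∀ C : ℝ, (∀ z, 0 ≤ f z) →
      (∀ z, f z ≤ C * (1 + ‖z‖ ^ 2)) →
        Integrable f l ∧ ∫ z, f z ∂l ≤ M fun ξ => ∫ z, f z ∂(ρ ξ) := by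
    intro f hf C hf0 hfC
    have hfa : ∀ z, |f z| ≤ C * (1 + ‖z‖ ^ 2) := fun z => by
      rw [abs_of_nonneg (hf0 z)]; exact hfC z
    have hcut : ∀ n z, cutoff n z * f z ≤ f z := fun n z =>
      mul_le_of_le_one_left (hf0 z) (cutoff_le_one n z)
    have hcut0 : ∀ n z, 0 ≤ cutoff n z * f z := fun n z => mul_nonneg (cutoff_nonneg n z) (hf0 z)
    have hlim : Filter.Tendsto (fun n => ∫⁻ z, ENNReal.ofReal (cutoff n z * f z) ∂l) Filter.atTop
        (nhds (∫⁻ z, ENNReal.ofReal (f z) ∂l)) := by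
      refine lintegral_tendsto_of_tendsto_of_monotone (fun n => ?_) (.of_forall fun z m n hmn => ?_)
        (.of_forall fun z => ?_)
      · exact ((continuous_cutoff n).mul hf).measurable.ennreal_ofReal.aemeasurable
      · exact ENNReal.ofReal_le_ofReal (mul_le_mul_of_nonneg_right (cutoff_mono z hmn) (hf0 z))
      · refine ENNReal.tendsto_ofReal ?_
        simpa using (tendsto_cutoff z).mul_const (f z)
    have hle : ∫⁻ z, ENNReal.ofReal (f z) ∂l
        ≤ ENNReal.ofReal (M fun ξ => ∫ z, f z ∂(ρ ξ)) := by
      refine le_of_tendsto' hlim fun n => ?_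
      have hic : Integrable (fun z => cutoff n z * f z) l :=
        CompactlySupportedContinuousMap.integrable (cut f hf n)
      rw [← ofReal_integral_eq_lintegral_ofReal hic (.of_forall (hcut0 n))]
      refine ENNReal.ofReal_le_ofReal ?_
      rw [int_cut f hf n]
      refine mono_T _ _ ((continuous_cutoff n).mul hf) hf C (fun z => ?_) hfa (hcut n)
      rw [abs_of_nonneg (hcut0 n z)]
      exact (hcut n z).trans (hfC z)
    have hi : Integrable f l := by
      refine ⟨hf.aestronglyMeasurable, ?_⟩
      rw [hasFiniteIntegral_iff_ofReal (.of_forall hf0)]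
      exact hle.trans_lt ENNReal.ofReal_lt_top
    refine ⟨hi, ?_⟩
    have hT0 : 0 ≤ M fun ξ => ∫ z, f z ∂(ρ ξ) := by
      refine (integral_nonneg (hcut0 0)).trans (a := 0) (b := ∫ z, cutoff 0 z * f z ∂l) ?_
      rw [int_cut f hf 0]
      refine mono_T _ _ ((continuous_cutoff 0).mul hf) hf C (fun z => ?_) hfa (hcut 0)
      rw [abs_of_nonneg (hcut0 0 z)]
      exact (hcut 0 z).trans (hfC z)
    rw [← ofReal_integral_eq_lintegral_ofReal hi (.of_forall hf0)] at hle
    exact (ENNReal.ofReal_le_ofReal_iff hT0).1 hle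
  have hfin : IsFiniteMeasure l := by
    have h1 := (quadratic_growth (fun _ => 1) continuous_const 1 (fun _ => zero_le_one)
      fun z => by nlinarith [sq_nonneg ‖z‖]).1
    rcases integrable_const_iff.1 h1 with h | h
    · exact absurd h one_ne_zero
    · exact h
  have hw := (quadratic_growth (fun z => 1 + ‖z‖ ^ 2) (by fun_prop) 1 (fun z => by positivity)
      fun z => (one_mul _).ge).1
  refine ⟨l, hfin, fun f hf C hC => ?_, quadratic_growth⟩
  have hC0 : 0 ≤ C := by simpa using (abs_nonneg _).trans (hC 0)
  have hfa : ∀ z, |f z| ≤ (2 * C) * (1 + ‖z‖ ^ 2) := fun z => by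
    refine (hC z).trans ?_
    nlinarith [sq_nonneg (‖z‖ - 1), sq_nonneg ‖z‖]
  have hi : Integrable f l :=
    (hw.const_mul (2 * C)).mono' hf.aestronglyMeasurable (.of_forall hfa)
  refine ⟨hi, ?_⟩
  have hcutb : ∀ n z, |cutoff n z * f z| ≤ |f z| := fun n z => by
    rw [abs_mul, abs_of_nonneg (cutoff_nonneg n z)]
    exact mul_le_of_le_one_left (abs_nonneg _) (cutoff_le_one n z)
  have lim1 : Filter.Tendsto (fun n => ∫ z, cutoff n z * f z ∂l) Filter.atTop
      (nhds (∫ z, f z ∂l)) := by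
    refine tendsto_integral_of_dominated_convergence (fun z => |f z|)
      (fun n => ((continuous_cutoff n).mul hf).aestronglyMeasurable) hi.abs
      (fun n => .of_forall (hcutb n)) (.of_forall fun z => ?_)
    simpa using (tendsto_cutoff z).mul_const (f z)
  have lim2 : Filter.Tendsto (fun n => ∫ z, cutoff n z * f z ∂l) Filter.atTop
      (nhds (M fun ξ => ∫ z, f z ∂(ρ ξ))) := by
    rw [tendsto_iff_norm_sub_tendsto_zero]
    refine squeeze_zero (g := fun n : ℕ => (2 * C * K) * (1 / ((n : ℝ) + 1)))
      (fun n => norm_nonneg _) (fun n => ?_) ?_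
    · rw [int_cut f hf n, ← map_sub, Real.norm_eq_abs]
      refine abs_M _ _ fun ξ => ?_
      have e : (∫ z, cutoff n z * f z ∂(ρ ξ)) - ∫ z, f z ∂(ρ ξ)
          = ∫ z, (cutoff n z * f z - f z) ∂(ρ ξ) :=
        (integral_sub (int_of _ ((continuous_cutoff n).mul hf) _
          (fun z => (hcutb n z).trans (hfa z)) ξ) (int_of f hf _ hfa ξ)).symm
      rw [Pi.sub_apply, e]
      refine (bound_of _ (((continuous_cutoff n).mul hf).sub hf) (2 * C * (1 / ((n : ℝ) + 1)))
        (by positivity) (fun z => ?_) ξ).trans (le_of_eq (by ring))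
      have e2 : cutoff n z * f z - f z = -((1 - cutoff n z) * f z) := by ring
      change |cutoff n z * f z - f z| ≤ _
      rw [e2, abs_neg, abs_mul, abs_of_nonneg (sub_nonneg.2 (cutoff_le_one n z))]
      calc (1 - cutoff n z) * |f z| ≤ (‖z‖ / (n + 1)) * (C * (1 + ‖z‖)) :=
            mul_le_mul (one_sub_cutoff_le n z) (hC z) (abs_nonneg _) (by positivity)
        _ = C * (1 / ((n : ℝ) + 1)) * (‖z‖ * (1 + ‖z‖)) := by ring
        _ ≤ C * (1 / ((n : ℝ) + 1)) * (2 * (1 + ‖z‖ ^ 2)) := by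
            refine mul_le_mul_of_nonneg_left ?_ (by positivity)
            nlinarith [sq_nonneg (‖z‖ - 1), sq_nonneg ‖z‖]
        _ = _ := by ring
    · simpa using tendsto_one_div_add_atTop_nhds_zero_nat.const_mul (2 * C * K)
  exact tendsto_nhds_unique lim1 lim2

/-- The sesquilinear form whose diagonal is `ξ ↦ c_{m,n}^ξ`. -/
def cForm {d : ℕ} (c : (Fin d → ℕ) → (Fin d → ℕ) → ℂ) (m n : Fin d → ℕ)
    (ξ η : (Fin d → ℕ) →₀ ℂ) : ℂ :=
  ξ.sum fun k a => η.sum fun l b => c (m + k) (n + l) * a * (starRingEnd ℂ) b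

section Form

variable {d : ℕ} (c : (Fin d → ℕ) → (Fin d → ℕ) → ℂ) (m n : Fin d → ℕ)

theorem cXi_eq_cForm (ξ : (Fin d → ℕ) →₀ ℂ) : cXi c ξ m n = cForm c m n ξ ξ := rfl

theorem cForm_single (k l : Fin d → ℕ) (a b : ℂ) :
    cForm c m n (single k a) (single l b) = c (m + k) (n + l) * a * (starRingEnd ℂ) b := by
  simp [cForm]

theorem cForm_add_left (ξ ξ' η : (Fin d → ℕ) →₀ ℂ) :
    cForm c m n (ξ + ξ') η = cForm c m n ξ η + cForm c m n ξ' η := by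
  refine sum_add_index' (fun k => by simp [Finsupp.sum]) fun k a a' => ?_
  rw [← sum_add]
  exact sum_congr fun l _ => by ring

theorem cForm_add_right (ξ η η' : (Fin d → ℕ) →₀ ℂ) :
    cForm c m n ξ (η + η') = cForm c m n ξ η + cForm c m n ξ η' := by
  rw [cForm, cForm, cForm, ← sum_add]
  exact sum_congr fun k _ => sum_add_index' (fun l => by simp) fun l b b' => by
    rw [map_add]; ring

theorem cForm_smul_left (s : ℂ) (ξ η : (Fin d → ℕ) →₀ ℂ) :
    cForm c m n (s • ξ) η = s * cForm c m n ξ η := by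
  rw [cForm, cForm, sum_smul_index (fun k => by simp [Finsupp.sum]), mul_sum]
  refine sum_congr fun k _ => ?_
  rw [mul_sum]
  exact sum_congr fun l _ => by ring

theorem cForm_smul_right (s : ℂ) (ξ η : (Fin d → ℕ) →₀ ℂ) :
    cForm c m n ξ (s • η) = (starRingEnd ℂ) s * cForm c m n ξ η := by
  rw [cForm, cForm, mul_sum]
  refine sum_congr fun k _ => ?_
  rw [sum_smul_index (fun k => by simp), mul_sum]
  exact sum_congr fun l _ => by rw [map_mul]; ring

theorem cForm_neg_left (ξ η : (Fin d → ℕ) →₀ ℂ) :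
    cForm c m n (-ξ) η = - cForm c m n ξ η := by
  simpa using cForm_smul_left c m n (-1) ξ η

theorem cForm_neg_right (ξ η : (Fin d → ℕ) →₀ ℂ) :
    cForm c m n ξ (-η) = - cForm c m n ξ η := by
  simpa using cForm_smul_right c m n (-1) ξ η

theorem cXi_parallelogram (ξ η : (Fin d → ℕ) →₀ ℂ) :
    cXi c (ξ + η) m n + cXi c (ξ - η) m n = 2 * cXi c ξ m n + 2 * cXi c η m n := by
  simp only [cXi_eq_cForm, sub_eq_add_neg, cForm_add_left, cForm_add_right, cForm_neg_left,
    cForm_neg_right]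
  ring

theorem cXi_smul (s : ℂ) (ξ : (Fin d → ℕ) →₀ ℂ) :
    cXi c (s • ξ) m n = normSq s * cXi c ξ m n := by
  rw [cXi_eq_cForm, cForm_smul_left, cForm_smul_right, ← mul_assoc, mul_conj, cXi_eq_cForm]

theorem cXi_I_smul (ξ : (Fin d → ℕ) →₀ ℂ) : cXi c (I • ξ) m n = cXi c ξ m n := by
  simp [cXi_smul]

theorem cXi_polarization (ξ η : (Fin d → ℕ) →₀ ℂ) :
    (cXi c (ξ + η) m n - cXi c (ξ - η) m n) / 4
      + (cXi c (ξ + I • η) m n - cXi c (ξ - I • η) m n) / 4 * I = cForm c m n ξ η := by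
  simp only [cXi_eq_cForm, sub_eq_add_neg, cForm_add_left, cForm_add_right, cForm_neg_left,
    cForm_neg_right, cForm_smul_left, cForm_smul_right, conj_I]
  ring_nf
  rw [I_sq]
  ring

end Form

theorem cmom_zero_zero {d : ℕ} (z : Fin d → ℂ) : cmom z 0 0 = 1 := by simp [cmom]

theorem cmom_single_zero {d : ℕ} (z : Fin d → ℂ) (i : Fin d) :
    cmom z (Pi.single i 1) 0 = z i := by
  simp [cmom, Pi.single_apply, pow_ite]

theorem cmom_single_single {d : ℕ} (z : Fin d → ℂ) (i : Fin d) :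
    cmom z (Pi.single i 1) (Pi.single i 1) = ((‖z i‖ ^ 2 : ℝ) : ℂ) := by
  simp [cmom, Pi.single_apply, pow_ite, mul_conj, normSq_eq_norm_sq]

/-- The second difference `μ_{ξ+η} + μ_{ξ-η} - 2 μ_ξ` of a family of measures. -/
def secondDiff {G X : Type*} [AddCommGroup G] [MeasurableSpace X] (μ : G → Measure X) (ξ η : G) :
    Measure X :=
  (μ (ξ + η) + μ (ξ - η)) - (μ ξ + μ ξ)

section SecondDiff

variable {G X : Type*} [AddCommGroup G] [MeasurableSpace X] {μ : G → Measure X}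

theorem measure_neg_eq_of_secondDiff (hfin : ∀ ξ, IsFiniteMeasure (μ ξ))
    (hμ : ∀ ξ η : G, ∀ σ : Set X, MeasurableSet σ → 2 * μ η σ ≤ μ (ξ + η) σ + μ (ξ - η) σ)
    (ξ : G) : μ (-ξ) = μ ξ := by
  have key : ∀ η : G, μ η ≤ μ (-η) := by
    intro η
    refine Measure.le_iff.2 fun σ hσ => ?_
    have h := hμ 0 η σ hσ
    rw [zero_add, zero_sub, two_mul] at h
    exact (ENNReal.add_le_add_iff_left (measure_ne_top _ _)).1 h
  refine le_antisymm ?_ (key ξ)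
  simpa using key (-ξ)

theorem secondDiff_add (hfin : ∀ ξ, IsFiniteMeasure (μ ξ))
    (hμ : ∀ ξ η : G, ∀ σ : Set X, MeasurableSet σ → 2 * μ η σ ≤ μ (ξ + η) σ + μ (ξ - η) σ)
    (ξ η : G) : secondDiff μ ξ η + (μ ξ + μ ξ) = μ (ξ + η) + μ (ξ - η) := by
  refine Measure.sub_add_cancel_of_le (Measure.le_iff.2 fun σ hσ => ?_)
  have h := hμ η ξ σ hσ
  rw [← neg_sub ξ η, measure_neg_eq_of_secondDiff hfin hμ, add_comm η, two_mul] at h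
  simpa using h

theorem integrable_secondDiff {f : X → ℝ} (hf : ∀ ξ, Integrable f (μ ξ)) (ξ η : G) :
    Integrable f (secondDiff μ ξ η) :=
  ((hf _).add_measure (hf _)).mono_measure Measure.sub_le

theorem integral_secondDiff (hfin : ∀ ξ, IsFiniteMeasure (μ ξ))
    (hμ : ∀ ξ η : G, ∀ σ : Set X, MeasurableSet σ → 2 * μ η σ ≤ μ (ξ + η) σ + μ (ξ - η) σ)
    {f : X → ℝ} (hf : ∀ ξ, Integrable f (μ ξ)) (ξ η : G) :
    ∫ z, f z ∂(secondDiff μ ξ η)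
      = ∫ z, f z ∂(μ (ξ + η)) + ∫ z, f z ∂(μ (ξ - η)) - 2 * ∫ z, f z ∂(μ ξ) := by
  have h : ∫ z, f z ∂(secondDiff μ ξ η + (μ ξ + μ ξ)) = ∫ z, f z ∂(μ (ξ + η) + μ (ξ - η)) := by
    rw [secondDiff_add hfin hμ]
  rw [integral_add_measure (integrable_secondDiff hf ξ η) ((hf ξ).add_measure (hf ξ)),
    integral_add_measure (hf ξ) (hf ξ), integral_add_measure (hf _) (hf _)] at h
  linarith

end SecondDiff

/-- Averaging the second differences of a function over the base point gives a function which
satisfies the parallelogram law. -/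
theorem mean_secondDiff_parallelogram {G : Type*} [AddCommGroup G] (M : (G → ℝ) →ₗ[ℝ] ℝ)
    (hM : ∀ (f : G → ℝ) (K : ℝ) (g : G), (∀ x, |f x| ≤ K) → M (fun x => f (x + g)) = M f)
    (m : G → ℝ) (K : G → ℝ) (hK : ∀ ξ η, |m (ξ + η) + m (ξ - η) - 2 * m ξ| ≤ K η) (η ζ : G) :
    M (fun ξ => m (ξ + (η + ζ)) + m (ξ - (η + ζ)) - 2 * m ξ)
      + M (fun ξ => m (ξ + (η - ζ)) + m (ξ - (η - ζ)) - 2 * m ξ)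
      = 2 * M (fun ξ => m (ξ + η) + m (ξ - η) - 2 * m ξ)
        + 2 * M (fun ξ => m (ξ + ζ) + m (ξ - ζ) - 2 * m ξ) := by
  have h1 := hM (fun ξ => m (ξ + ζ) + m (ξ - ζ) - 2 * m ξ) (K ζ) η fun ξ => hK ξ ζ
  have h2 := hM (fun ξ => m (ξ + ζ) + m (ξ - ζ) - 2 * m ξ) (K ζ) (-η) fun ξ => hK ξ ζ
  have h3 : M (fun ξ => m (ξ + (η + ζ)) + m (ξ - (η + ζ)) - 2 * m ξ)
      + M (fun ξ => m (ξ + (η - ζ)) + m (ξ - (η - ζ)) - 2 * m ξ)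
      = M (fun ξ => m (ξ + η + ζ) + m (ξ + η - ζ) - 2 * m (ξ + η))
        + M (fun ξ => m (ξ + -η + ζ) + m (ξ + -η - ζ) - 2 * m (ξ + -η))
        + (2 : ℝ) • M (fun ξ => m (ξ + η) + m (ξ - η) - 2 * m ξ) := by
    rw [← map_smul, ← map_add, ← map_add, ← map_add]
    congr 1
    funext ξ
    simp only [Pi.add_apply, Pi.smul_apply, smul_eq_mul]
    rw [← add_assoc ξ η ζ, show ξ - (η + ζ) = ξ + -η - ζ by abel,
      show ξ + (η - ζ) = ξ + η - ζ by abel, show ξ - (η - ζ) = ξ + -η + ζ by abel,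
      ← sub_eq_add_neg ξ η]
    ring
  rw [h3, h1, h2, smul_eq_mul]
  ring

/-- From a family of measures solving the truncated problems one gets a family depending
quadratically on the parameter, at the cost of an inequality for the second moments. -/
theorem exists_quadratic_family {d : ℕ} (c : (Fin d → ℕ) → (Fin d → ℕ) → ℂ)
    (μ : ((Fin d → ℕ) →₀ ℂ) → Measure (Fin d → ℂ))
    (hc : ∀ ξ : (Fin d → ℕ) →₀ ℂ, ∀ m n : Fin d → ℕ, (∑ i, m i ≤ 1) → (∑ i, n i ≤ 1) →
      Integrable (fun z => cmom z m n) (μ ξ) ∧ cXi c ξ m n = ∫ z, cmom z m n ∂(μ ξ))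
    (hμ : ∀ ξ η : (Fin d → ℕ) →₀ ℂ, ∀ σ : Set (Fin d → ℂ), MeasurableSet σ →
      2 * μ η σ ≤ μ (ξ + η) σ + μ (ξ - η) σ) :
    ∃ l : ((Fin d → ℕ) →₀ ℂ) → Measure (Fin d → ℂ), (∀ η, IsFiniteMeasure (l η)) ∧
      (∀ ξ η, l (ξ + η) + l (ξ - η) = (l ξ + l ξ) + (l η + l η)) ∧
      (∀ η, l (I • η) = l η) ∧
      (∀ η, ((l η).real Set.univ : ℂ) = cXi c η 0 0) ∧
      (∀ η i, Integrable (fun z => z i) (l η) ∧ ∫ z, z i ∂(l η) = cXi c η (Pi.single i 1) 0) ∧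
      ∀ η i, Integrable (fun z => ‖z i‖ ^ 2) (l η) ∧
        ∫ z, ‖z i‖ ^ 2 ∂(l η) ≤ (cXi c η (Pi.single i 1) (Pi.single i 1)).re := by
  have hs0 : ∑ i : Fin d, (0 : Fin d → ℕ) i ≤ 1 := by simp
  have hs1 : ∀ j : Fin d, ∑ i : Fin d, (Pi.single j 1 : Fin d → ℕ) i ≤ 1 := fun j => by simp
  have hfin : ∀ ξ, IsFiniteMeasure (μ ξ) := by
    intro ξ
    have h := (hc ξ 0 0 hs0 hs0).1
    simp only [cmom_zero_zero] at h
    rcases integrable_const_iff.1 h with h | h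
    · exact absurd h one_ne_zero
    · exact h
  have c00 : ∀ ξ, cXi c ξ 0 0 = ((∫ _, (1 : ℝ) ∂(μ ξ) : ℝ) : ℂ) := by
    intro ξ
    rw [(hc ξ 0 0 hs0 hs0).2]
    simp [cmom_zero_zero]
  have c10 : ∀ ξ i, Integrable (fun z => z i) (μ ξ) ∧
      cXi c ξ (Pi.single i 1) 0 = ∫ z, z i ∂(μ ξ) := by
    intro ξ i
    simpa only [cmom_single_zero] using hc ξ _ _ (hs1 i) hs0
  have c11 : ∀ ξ i, Integrable (fun z => ‖z i‖ ^ 2) (μ ξ) ∧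
      cXi c ξ (Pi.single i 1) (Pi.single i 1) = ((∫ z, ‖z i‖ ^ 2 ∂(μ ξ) : ℝ) : ℂ) := by
    intro ξ i
    have h := hc ξ _ _ (hs1 i) (hs1 i)
    simp only [cmom_single_single] at h
    rw [integral_complex_ofReal] at h
    exact ⟨h.1.re, h.2⟩
  obtain ⟨M, hM, hMinv⟩ := exists_invariant_mean ((Fin d → ℕ) →₀ ℂ)
  have M_const : ∀ a : ℝ, M (fun _ => a) = a := by
    intro a
    refine le_antisymm (hM _ a |a| (fun _ => le_rfl) fun _ => le_rfl) ?_
    have h := hM (-fun _ => a) (-a) |a| (fun _ => by simp) fun _ => le_rfl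
    rw [map_neg] at h
    linarith
  let ρ : ((Fin d → ℕ) →₀ ℂ) → ((Fin d → ℕ) →₀ ℂ) → Measure (Fin d → ℂ) := fun η ξ =>
    (4⁻¹ : NNReal) • (secondDiff μ ξ η + secondDiff μ ξ (I • η))
  have ρ_int : ∀ f : (Fin d → ℂ) → ℝ, (∀ ξ, Integrable f (μ ξ)) → ∀ η ξ, Integrable f (ρ η ξ) :=
    fun f hf η ξ => ((integrable_secondDiff hf _ _).add_measure
      (integrable_secondDiff hf _ _)).smul_measure_nnreal
  have ρ_integral : ∀ f : (Fin d → ℂ) → ℝ, (∀ ξ, Integrable f (μ ξ)) → ∀ η ξ,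
      ∫ z, f z ∂(ρ η ξ) = (4⁻¹ : ℝ) *
        ((∫ z, f z ∂(μ (ξ + η)) + ∫ z, f z ∂(μ (ξ - η)) - 2 * ∫ z, f z ∂(μ ξ))
          + (∫ z, f z ∂(μ (ξ + I • η)) + ∫ z, f z ∂(μ (ξ - I • η)) - 2 * ∫ z, f z ∂(μ ξ))) := by
    intro f hf η ξ
    rw [← integral_secondDiff hfin hμ hf, ← integral_secondDiff hfin hμ hf,
      ← integral_add_measure (integrable_secondDiff hf _ _) (integrable_secondDiff hf _ _)]
    simp only [ρ, integral_smul_nnreal_measure]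
    rw [NNReal.smul_def, smul_eq_mul]
    simp
  have ρ_quad : ∀ f : (Fin d → ℂ) → ℝ, (∀ ξ, Integrable f (μ ξ)) →
      (∀ ξ η, ∫ z, f z ∂(μ (ξ + η)) + ∫ z, f z ∂(μ (ξ - η))
        = 2 * ∫ z, f z ∂(μ ξ) + 2 * ∫ z, f z ∂(μ η)) →
      (∀ ξ, ∫ z, f z ∂(μ (I • ξ)) = ∫ z, f z ∂(μ ξ)) →
      ∀ η ξ, ∫ z, f z ∂(ρ η ξ) = ∫ z, f z ∂(μ η) := by
    intro f hf hp hI η ξ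
    rw [ρ_integral f hf, hp, hp, hI]
    ring
  have one_int : ∀ ξ, Integrable (fun _ : Fin d → ℂ => (1 : ℝ)) (μ ξ) := fun ξ =>
    integrable_const _
  have quad_of : ∀ (m n : Fin d → ℕ) (f : (Fin d → ℂ) → ℝ),
      (∀ ξ, ∫ z, f z ∂(μ ξ) = (cXi c ξ m n).re) → (∀ ξ, Integrable f (μ ξ)) →
      ∀ η ξ, ∫ z, f z ∂(ρ η ξ) = (cXi c η m n).re := by
    intro m n f h1 h2 η ξ
    rw [ρ_quad f h2, h1]
    · intro ξ η
      rw [h1, h1, h1, h1]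
      simpa using congrArg Complex.re (cXi_parallelogram c m n ξ η)
    · intro ξ
      rw [h1, h1, cXi_I_smul]
  have quad_of_im : ∀ (m n : Fin d → ℕ) (f : (Fin d → ℂ) → ℝ),
      (∀ ξ, ∫ z, f z ∂(μ ξ) = (cXi c ξ m n).im) → (∀ ξ, Integrable f (μ ξ)) →
      ∀ η ξ, ∫ z, f z ∂(ρ η ξ) = (cXi c η m n).im := by
    intro m n f h1 h2 η ξ
    rw [ρ_quad f h2, h1]
    · intro ξ η
      rw [h1, h1, h1, h1]
      simpa using congrArg Complex.im (cXi_parallelogram c m n ξ η)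
    · intro ξ
      rw [h1, h1, cXi_I_smul]
  have r00 := quad_of 0 0 (fun _ => 1) (fun ξ => by rw [c00, ofReal_re]) one_int
  have r11 := fun i => quad_of (Pi.single i 1) (Pi.single i 1) (fun z => ‖z i‖ ^ 2)
    (fun ξ => by rw [(c11 ξ i).2, ofReal_re]) fun ξ => (c11 ξ i).1
  have r10 := fun i => quad_of (Pi.single i 1) 0 (fun z => (z i).re)
    (fun ξ => by rw [(c10 ξ i).2]; exact integral_re (c10 ξ i).1) fun ξ => (c10 ξ i).1.re
  have i10 := fun i => quad_of_im (Pi.single i 1) 0 (fun z => (z i).im)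
    (fun ξ => by rw [(c10 ξ i).2]; exact integral_im (c10 ξ i).1) fun ξ => (c10 ξ i).1.im
  have norm_sq_le : ∀ z : Fin d → ℂ, ‖z‖ ^ 2 ≤ ∑ i, ‖z i‖ ^ 2 := by
    intro z
    have h0 : 0 ≤ ∑ i, ‖z i‖ ^ 2 := Finset.sum_nonneg fun i _ => by positivity
    rw [← Real.le_sqrt (norm_nonneg _) h0]
    refine (pi_norm_le_iff_of_nonneg (Real.sqrt_nonneg _)).2 fun i => ?_
    rw [Real.le_sqrt (norm_nonneg _) h0]
    exact Finset.single_le_sum (f := fun i => ‖z i‖ ^ 2) (fun i _ => by positivity)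
      (Finset.mem_univ i)
  have wint : ∀ η ξ, Integrable (fun z : Fin d → ℂ => 1 + ∑ i, ‖z i‖ ^ 2) (ρ η ξ) := fun η ξ =>
    (ρ_int _ one_int η ξ).add
      (integrable_finsetSum _ fun i _ => ρ_int _ (fun ξ => (c11 ξ i).1) η ξ)
  have hmeas : ∀ η ξ, Integrable (fun z : Fin d → ℂ => 1 + ‖z‖ ^ 2) (ρ η ξ) := by
    intro η ξ
    refine (wint η ξ).mono' (by fun_prop) (.of_forall fun z => ?_)
    rw [Real.norm_eq_abs, abs_of_nonneg (by positivity)]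
    linarith [norm_sq_le z]
  have hbd : ∀ η ξ, ∫ z, (1 + ‖z‖ ^ 2) ∂(ρ η ξ) ≤ (cXi c η 0 0).re
      + ∑ i, (cXi c η (Pi.single i 1) (Pi.single i 1)).re := by
    intro η ξ
    refine (integral_mono (hmeas η ξ) (wint η ξ) fun z => by
      simpa using norm_sq_le z).trans (le_of_eq ?_)
    rw [integral_add (ρ_int _ one_int η ξ)
      (integrable_finsetSum _ fun i _ => ρ_int _ (fun ξ => (c11 ξ i).1) η ξ), r00,
      integral_finsetSum _ fun i _ => ρ_int _ (fun ξ => (c11 ξ i).1) η ξ]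
    exact congrArg _ (Finset.sum_congr rfl fun i _ => r11 i η ξ)
  choose l lfin llin lquad using fun η => exists_measure_of_mean M hM (ρ η) _ (hmeas η) (hbd η)
  have coord : ∀ (z : Fin d → ℂ) i, ‖z i‖ ≤ 1 * (1 + ‖z‖) := fun z i => by
    linarith [norm_le_pi_norm z i]
  have mean_of_parallelogram : ∀ f : BoundedContinuousFunction (Fin d → ℂ) ℝ, ∀ η,
      ∫ z, f z ∂(l η) = (4⁻¹ : ℝ) *
        (M (fun ξ => ∫ z, f z ∂(μ (ξ + η)) + ∫ z, f z ∂(μ (ξ - η)) - 2 * ∫ z, f z ∂(μ ξ))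
        + M (fun ξ => ∫ z, f z ∂(μ (ξ + I • η)) + ∫ z, f z ∂(μ (ξ - I • η))
          - 2 * ∫ z, f z ∂(μ ξ))) := by
    intro f η
    rw [(llin η f f.continuous ‖f‖ fun z => (f.norm_coe_le_norm z).trans
      (le_mul_of_one_le_right (norm_nonneg _) (by linarith [norm_nonneg z]))).2, ← map_add,
      ← smul_eq_mul, ← map_smul]
    congr 1
    funext ξ
    exact ρ_integral f (fun ξ => f.integrable _) η ξ
  have sd_bound : ∀ (f : BoundedContinuousFunction (Fin d → ℂ) ℝ) ξ η,
      |∫ z, f z ∂(μ (ξ + η)) + ∫ z, f z ∂(μ (ξ - η)) - 2 * ∫ z, f z ∂(μ ξ)|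
        ≤ ‖f‖ * (2 * (cXi c η 0 0).re) := by
    intro f ξ η
    rw [← integral_secondDiff hfin hμ fun ξ => f.integrable _]
    calc _ ≤ ∫ z, ‖f‖ * 1 ∂(secondDiff μ ξ η) :=
          norm_integral_le_of_norm_le (f := f) ((integrable_secondDiff one_int ξ η).const_mul _)
            (.of_forall fun z => by simpa using f.norm_coe_le_norm z)
      _ = _ := by
        rw [integral_const_mul, integral_secondDiff hfin hμ one_int]
        have h := congrArg Complex.re (cXi_parallelogram c 0 0 ξ η)
        simp only [c00, add_re, mul_re, ofReal_re, ofReal_im, re_ofNat, im_ofNat] at h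
        rw [c00, ofReal_re]
        congr 1
        linarith
  refine ⟨l, lfin, fun ξ η => ?_, fun η => ?_, fun η => ?_, fun η i => ?_, fun η i => ?_⟩
  · refine ext_of_forall_integral_eq_of_IsFiniteMeasure fun f => ?_
    have hi : ∀ η, Integrable f (l η) := fun η => f.integrable _
    rw [integral_add_measure (hi _) (hi _),
      integral_add_measure ((hi _).add_measure (hi _)) ((hi _).add_measure (hi _)),
      integral_add_measure (hi _) (hi _), integral_add_measure (hi _) (hi _)]
    simp only [mean_of_parallelogram]
    have h := mean_secondDiff_parallelogram M hMinv (fun ξ => ∫ z, f z ∂(μ ξ)) _ (sd_bound f)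
    have h1 := h ξ η
    have h2 := h (I • ξ) (I • η)
    rw [← smul_add, ← smul_sub] at h2
    linarith
  · refine ext_of_forall_integral_eq_of_IsFiniteMeasure fun f => ?_
    rw [mean_of_parallelogram, mean_of_parallelogram, smul_smul, I_mul_I, neg_one_smul, add_comm]
    simp only [sub_neg_eq_add, ← sub_eq_add_neg]
    simp only [add_comm (∫ z, f z ∂(μ (_ - η)))]
  · have h := (llin η (fun _ => 1) continuous_const 1 fun z => by simp).2
    simp only [r00, M_const] at h
    rw [c00 η, ofReal_inj]
    rw [c00 η, ofReal_re] at h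
    rw [← h]
    simp
  · have h1 := llin η (fun z => (z i).re) (by fun_prop) 1 fun z =>
      (abs_re_le_norm _).trans (coord z i)
    have h2 := llin η (fun z => (z i).im) (by fun_prop) 1 fun z =>
      (abs_im_le_norm _).trans (coord z i)
    simp only [r10, i10, M_const] at h1 h2
    have hi : Integrable (fun z : Fin d → ℂ => z i) (l η) :=
      (Integrable.re_im_iff (𝕜 := ℂ)).1 ⟨h1.1, h2.1⟩
    refine ⟨hi, Complex.ext ?_ ?_⟩
    · rw [← h1.2]; exact (integral_re hi).symm
    · rw [← h2.2]; exact (integral_im hi).symm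
  · have h := lquad η (fun z => ‖z i‖ ^ 2) (by fun_prop) 1 (fun z => by positivity) fun z => by
      have := pow_le_pow_left₀ (norm_nonneg _) (norm_le_pi_norm z i) 2
      linarith
    simpa only [r11, M_const] using h

theorem polar_sum {E ι : Type*} [AddCommGroup E] [Module ℂ E] {q : E → ℝ}
    (hq : ∀ x y, q (x + y) + q (x - y) = 2 * q x + 2 * q y) (h0 : ∀ x, 0 ≤ q x)
    (hb : ∀ x : E, ∃ C : ℝ, ∀ t : ℝ, |t| ≤ 1 → q ((t : ℂ) • x) ≤ C)
    (hI : ∀ x, q (I • x) = q x) (S : Finset ι) (s : ι → ℂ) (x : ι → E) :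
    (q (∑ i ∈ S, s i • x i) : ℂ)
      = ∑ i ∈ S, ∑ j ∈ S, s i * (starRingEnd ℂ) (s j) * polar q (x i) (x j) := by
  let L : E → E →+ ℂ := fun y => AddMonoidHom.mk' (fun x => polar q x y) fun a b =>
    polar_add_left hq a b y
  let R : E → E →+ ℂ := fun y => AddMonoidHom.mk' (fun x => polar q y x) fun a b =>
    polar_add_right hq a b y
  have hL : ∀ y (f : ι → E), polar q (∑ i ∈ S, f i) y = ∑ i ∈ S, polar q (f i) y := fun y f =>
    map_sum (L y) f S
  have hR : ∀ y (f : ι → E), polar q y (∑ i ∈ S, f i) = ∑ i ∈ S, polar q y (f i) := fun y f =>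
    map_sum (R y) f S
  rw [← polar_self hq hI, hL]
  refine Finset.sum_congr rfl fun i _ => ?_
  rw [hR]
  refine Finset.sum_congr rfl fun j _ => ?_
  rw [polar_smul_left hq h0 hb hI, polar_smul_right hq h0 hb hI, mul_assoc]

/-- If `a - w b` is a null vector of a positive semidefinite kernel, then it is orthogonal to every
`c`. -/
theorem kernel_eq_mul_of_null {ι : Type*} {κ : ι → ι → ℂ}
    (herm : ∀ i j, (starRingEnd ℂ) (κ i j) = κ j i)
    (psd : ∀ (x : Fin 3 → ι) (s : Fin 3 → ℂ),
      0 ≤ (∑ i, ∑ j, s i * (starRingEnd ℂ) (s j) * κ (x i) (x j)).re)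
    (a b c : ι) (w : ℂ)
    (h : (κ a a).re - 2 * (w * κ b a).re + ‖w‖ ^ 2 * (κ b b).re = 0) :
    κ a c = w * κ b c := by
  set D := κ a c - w * κ b c with hD
  have key : ∀ r : ℝ, 0 ≤ - (2 * r * normSq D) + r ^ 2 * normSq D * (κ c c).re := by
    intro r
    have h1 := psd ![a, b, c] ![1, -w, -(r * D)]
    simp only [Fin.sum_univ_three, Matrix.cons_val_zero, Matrix.cons_val_one, Matrix.cons_val]
      at h1
    rw [← herm b a, ← herm a c, ← herm b c] at h1
    have him : ∀ i, (κ i i).im = 0 := fun i => by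
      have := congrArg Complex.im (herm i i)
      simp at this
      linarith
    rw [← normSq_eq_norm_sq] at h
    simp only [normSq_apply, hD, map_neg, map_mul, map_one, add_re, mul_re, mul_im, neg_re, neg_im,
      conj_re, conj_im, sub_re, sub_im, ofReal_re, ofReal_im, one_re, one_im, him, conj_ofReal]
      at h h1 ⊢
    linarith
  have hcc : 0 ≤ (κ c c).re := by
    have h1 := psd ![c, c, c] ![1, 0, 0]
    simpa [Fin.sum_univ_three] using h1
  have h2 := key (1 / ((κ c c).re + 1))
  have hp : 0 < (κ c c).re + 1 := by linarith
  have h3 : - (2 * (1 / ((κ c c).re + 1)) * normSq D)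
      + (1 / ((κ c c).re + 1)) ^ 2 * normSq D * (κ c c).re
      = - (normSq D * ((κ c c).re + 2) / ((κ c c).re + 1) ^ 2) := by
    field_simp
    ring
  rw [h3, neg_nonneg] at h2
  have h4 : normSq D * ((κ c c).re + 2) ≤ 0 := by
    by_contra! hlt
    exact absurd h2 (not_le.2 (by positivity))
  have h5 : normSq D ≤ 0 := by
    by_contra! hlt
    exact absurd h4 (not_le.2 (by positivity))
  have h6 : D = 0 := normSq_eq_zero.1 (le_antisymm h5 (normSq_nonneg _))
  exact sub_eq_zero.1 h6

theorem kernel_eq_cmom {d : ℕ} {κ : (Fin d → ℕ) → (Fin d → ℕ) → ℂ} (z : Fin d → ℂ)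
    (herm : ∀ i j, (starRingEnd ℂ) (κ i j) = κ j i)
    (shift : ∀ i k l, κ (Pi.single i 1 + k) l = z i * κ k l) (k l : Fin d → ℕ) :
    κ k l = cmom z k l * κ 0 0 := by
  have left : ∀ (N : ℕ) (k l : Fin d → ℕ), ∑ i, k i = N → κ k l = (∏ i, z i ^ k i) * κ 0 l := by
    intro N
    induction N with
    | zero =>
      intro k l hk
      have : k = 0 := by
        funext i
        exact (Finset.sum_eq_zero_iff.1 hk) i (Finset.mem_univ i)
      simp [this]
    | succ N ih =>
      intro k l hk
      obtain ⟨i, hi⟩ : ∃ i, k i ≠ 0 := by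
        by_contra! hcon
        simp [hcon] at hk
      have hle : Pi.single i 1 ≤ k := by
        intro j
        by_cases hj : j = i
        · subst hj; simpa using Nat.one_le_iff_ne_zero.2 hi
        · simp [hj]
      obtain ⟨k', rfl⟩ := exists_add_of_le hle
      have hk' : ∑ j, k' j = N := by
        simp [Finset.sum_add_distrib] at hk
        omega
      rw [shift, ih k' l hk']
      simp only [Pi.add_apply, pow_add, Finset.prod_mul_distrib, Pi.single_apply, pow_ite, pow_one,
        pow_zero, Finset.prod_ite_eq', Finset.mem_univ, if_true]
      ring
  rw [left _ k l rfl, ← herm l 0, left _ l 0 rfl, map_mul, herm, cmom, map_prod]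
  simp only [map_pow]
  ring

section KernelDensity

variable {E Ω : Type*} [AddCommGroup E] [Module ℂ E] [MeasurableSpace Ω]

/-- The density with respect to `τ` of the polarization of a family of measures. -/
def kernelDensity (l : E → Measure Ω) (τ : Measure Ω) (ξ η : E) (z : Ω) : ℂ :=
  polar (fun x => ((l x).rnDeriv τ z).toReal) ξ η

variable {l : E → Measure Ω} [∀ x, IsFiniteMeasure (l x)]
  (hpar : ∀ ξ η, l (ξ + η) + l (ξ - η) = (l ξ + l ξ) + (l η + l η))
  (hI : ∀ η, l (I • η) = l η) {τ : Measure Ω} [IsFiniteMeasure τ]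

omit [Module ℂ E] [∀ (x : E), IsFiniteMeasure (l x)] [IsFiniteMeasure τ] in
include hpar in
theorem absolutelyContinuous_add {ξ η : E} (hξ : l ξ ≪ τ) (hη : l η ≪ τ) :
    l (ξ + η) ≪ τ ∧ l (ξ - η) ≪ τ := by
  have h : l (ξ + η) + l (ξ - η) ≪ τ := by
    rw [hpar]
    exact (hξ.add_left hξ).add_left (hη.add_left hη)
  exact Measure.AbsolutelyContinuous.add_left_iff.1 h

include hpar hI in
theorem kernelDensity_integral {ξ η : E} (hξ : l ξ ≪ τ) (hη : l η ≪ τ) {f : Ω → ℂ}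
    (hf : ∀ x, Integrable f (l x)) :
    Integrable (fun z => f z * kernelDensity l τ ξ η z) τ ∧
      ∫ z, f z * kernelDensity l τ ξ η z ∂τ =
        ((∫ z, f z ∂(l (ξ + η))) - ∫ z, f z ∂(l (ξ - η))) / 4
          + ((∫ z, f z ∂(l (ξ + I • η))) - ∫ z, f z ∂(l (ξ - I • η))) / 4 * I := by
  have hη' : l (I • η) ≪ τ := by rwa [hI]
  obtain ⟨h1, h2⟩ := absolutelyContinuous_add hpar hξ hη
  obtain ⟨h3, h4⟩ := absolutelyContinuous_add hpar hξ hη'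
  have e : (fun z => f z * kernelDensity l τ ξ η z) = fun z =>
      (((l (ξ + η)).rnDeriv τ z).toReal • f z - ((l (ξ - η)).rnDeriv τ z).toReal • f z) / 4
      + (((l (ξ + I • η)).rnDeriv τ z).toReal • f z
        - ((l (ξ - I • η)).rnDeriv τ z).toReal • f z) / 4 * I := by
    funext z
    simp only [kernelDensity, polar, polarRe, real_smul]
    push_cast
    ring
  have i1 := (integrable_rnDeriv_smul_iff h1).2 (hf _)
  have i2 := (integrable_rnDeriv_smul_iff h2).2 (hf _)
  have i3 := (integrable_rnDeriv_smul_iff h3).2 (hf _)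
  have i4 := (integrable_rnDeriv_smul_iff h4).2 (hf _)
  have j1 := (i1.sub i2).div_const 4
  have j2 := ((i3.sub i4).div_const 4).mul_const I
  rw [e]
  refine ⟨j1.add j2, ?_⟩
  rw [← integral_rnDeriv_smul h1, ← integral_rnDeriv_smul h2, ← integral_rnDeriv_smul h3,
    ← integral_rnDeriv_smul h4, ← integral_sub i1 i2, ← integral_sub i3 i4, ← integral_div,
    ← integral_div, ← integral_mul_const]
  exact integral_add j1 j2

include hpar hI in
theorem kernelDensity_setIntegral {ξ η : E} (hξ : l ξ ≪ τ) (hη : l η ≪ τ) {σ : Set Ω}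
    (hσ : MeasurableSet σ) :
    ∫ z in σ, kernelDensity l τ ξ η z ∂τ = polar (fun x => (l x).real σ) ξ η := by
  have h := (kernelDensity_integral hpar hI hξ hη (f := σ.indicator fun _ => 1)
    fun x => (integrable_const 1).indicator hσ).2
  have e : (fun z => σ.indicator (fun _ => (1 : ℂ)) z * kernelDensity l τ ξ η z)
      = σ.indicator (kernelDensity l τ ξ η) := by
    funext z
    by_cases hz : z ∈ σ <;> simp [hz]
  rw [e, integral_indicator hσ] at h
  rw [h]
  simp [integral_indicator hσ, polar, polarRe]

include hpar hI in
theorem integrable_kernelDensity {ξ η : E} (hξ : l ξ ≪ τ) (hη : l η ≪ τ) :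
    Integrable (kernelDensity l τ ξ η) τ := by
  simpa using (kernelDensity_integral hpar hI hξ hη (f := fun _ => 1)
    fun x => integrable_const 1).1

omit [Module ℂ E] in
include hpar in
theorem measureReal_parallelogram (σ : Set Ω) (ξ η : E) :
    (l (ξ + η)).real σ + (l (ξ - η)).real σ = 2 * (l ξ).real σ + 2 * (l η).real σ := by
  have := congrArg (fun m : Measure Ω => m.real σ) (hpar ξ η)
  beta_reduce at this
  rw [measureReal_add_apply, measureReal_add_apply, measureReal_add_apply, measureReal_add_apply]
    at this
  linarith

include hpar hI in
theorem kernelDensity_conj {ξ η : E} (hξ : l ξ ≪ τ) (hη : l η ≪ τ) :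
    ∀ᵐ z ∂τ, (starRingEnd ℂ) (kernelDensity l τ ξ η z) = kernelDensity l τ η ξ z := by
  have h_int := integrable_kernelDensity hpar hI hξ hη
  refine Integrable.ae_eq_of_forall_setIntegral_eq _ _ ?_
    (integrable_kernelDensity hpar hI hη hξ) fun σ hσ _ => ?_
  · exact (conjCLE.toContinuousLinearMap).integrable_comp h_int
  · rw [integral_conj, kernelDensity_setIntegral hpar hI hξ hη hσ,
      kernelDensity_setIntegral hpar hI hη hξ hσ]
    exact polar_conj_symm (measureReal_parallelogram hpar σ)
      (fun x => by simp only [hI]) ξ η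

include hpar hI in
theorem kernelDensity_self {ξ : E} (hξ : l ξ ≪ τ) :
    ∀ᵐ z ∂τ, kernelDensity l τ ξ ξ z = ((l ξ).rnDeriv τ z).toReal := by
  refine Integrable.ae_eq_of_forall_setIntegral_eq _ _ (integrable_kernelDensity hpar hI hξ hξ)
    Measure.integrable_toReal_rnDeriv.ofReal fun σ hσ _ => ?_
  rw [kernelDensity_setIntegral hpar hI hξ hξ hσ, integral_complex_ofReal,
    Measure.setIntegral_toReal_rnDeriv hξ]
  exact polar_self (measureReal_parallelogram hpar σ) (fun x => by simp only [hI]) ξ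

variable (hb : ∀ x : E, ∃ C : ℝ, ∀ t : ℝ, |t| ≤ 1 → (l ((t : ℂ) • x)).real Set.univ ≤ C)

include hpar hI hb in
theorem kernelDensity_nonneg {ι : Type*} [Fintype ι] {x : ι → E} (hx : ∀ i, l (x i) ≪ τ) :
    ∀ᵐ z ∂τ, ∀ s : ι → ℂ,
      0 ≤ (∑ i, ∑ j, s i * (starRingEnd ℂ) (s j) * kernelDensity l τ (x i) (x j) z).re := by
  have key : ∀ s : ι → ℂ, ∀ᵐ z ∂τ,
      0 ≤ (∑ i, ∑ j, s i * (starRingEnd ℂ) (s j) * kernelDensity l τ (x i) (x j) z).re := by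
    intro s
    have hterm : ∀ i j, Integrable
        (fun z => s i * (starRingEnd ℂ) (s j) * kernelDensity l τ (x i) (x j) z) τ := fun i j =>
      (integrable_kernelDensity hpar hI (hx i) (hx j)).const_mul _
    have hsum : Integrable
        (fun z => ∑ i, ∑ j, s i * (starRingEnd ℂ) (s j) * kernelDensity l τ (x i) (x j) z) τ :=
      integrable_finsetSum _ fun i _ => integrable_finsetSum _ fun j _ => hterm i j
    refine ae_nonneg_of_forall_setIntegral_nonneg hsum.re fun σ hσ _ => ?_
    have h1 : ∫ z in σ, ∑ i, ∑ j, s i * (starRingEnd ℂ) (s j) *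
        kernelDensity l τ (x i) (x j) z ∂τ = ((l (∑ i, s i • x i)).real σ : ℝ) := by
      rw [polar_sum (q := fun y => (l y).real σ) (measureReal_parallelogram hpar σ)
          (fun y => measureReal_nonneg) ?_ (fun y => by simp only [hI]),
        integral_finsetSum _ fun i _ => integrable_finsetSum _ fun j _ => (hterm i j).integrableOn]
      · refine Finset.sum_congr rfl fun i _ => ?_
        rw [integral_finsetSum _ fun j _ => (hterm i j).integrableOn]
        refine Finset.sum_congr rfl fun j _ => ?_
        rw [integral_const_mul, kernelDensity_setIntegral hpar hI (hx i) (hx j) hσ]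
      · intro y
        obtain ⟨C, hC⟩ := hb y
        exact ⟨C, fun t ht => (measureReal_mono (Set.subset_univ σ)).trans (hC t ht)⟩
    have h2 := integral_re (𝕜 := ℂ) (hsum.integrableOn (s := σ))
    rw [h1, RCLike.re_to_complex, ofReal_re] at h2
    exact measureReal_nonneg.trans_eq h2.symm
  have hdense := ae_all_iff.2 fun n => key (TopologicalSpace.denseSeq (ι → ℂ) n)
  filter_upwards [hdense] with z hz
  have hcont : Continuous fun s : ι → ℂ =>
      (∑ i, ∑ j, s i * (starRingEnd ℂ) (s j) * kernelDensity l τ (x i) (x j) z).re := by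
    refine continuous_re.comp (continuous_finsetSum _ fun i _ => continuous_finsetSum _ fun j _ =>
      ((continuous_apply i).mul (continuous_conj.comp (continuous_apply j))).mul continuous_const)
  intro s
  have := (TopologicalSpace.denseRange_denseSeq (ι → ℂ)).closure_range
  have hclosed : IsClosed {s : ι → ℂ | 0 ≤
      (∑ i, ∑ j, s i * (starRingEnd ℂ) (s j) * kernelDensity l τ (x i) (x j) z).re} :=
    isClosed_le continuous_const hcont
  have hsub := closure_minimal (s := Set.range (TopologicalSpace.denseSeq (ι → ℂ)))
    (by rintro _ ⟨n, rfl⟩; exact hz n) hclosed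
  rw [this] at hsub
  exact hsub (Set.mem_univ s)

end KernelDensity

theorem moment_of_quadratic_family {d : ℕ} (c : (Fin d → ℕ) → (Fin d → ℕ) → ℂ)
    (l : ((Fin d → ℕ) →₀ ℂ) → Measure (Fin d → ℂ)) [∀ η, IsFiniteMeasure (l η)]
    (hpar : ∀ ξ η, l (ξ + η) + l (ξ - η) = (l ξ + l ξ) + (l η + l η))
    (hI : ∀ η, l (I • η) = l η)
    (h00 : ∀ η, ((l η).real Set.univ : ℂ) = cXi c η 0 0)
    (h10 : ∀ η i, Integrable (fun z => z i) (l η) ∧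
      ∫ z, z i ∂(l η) = cXi c η (Pi.single i 1) 0)
    (h11 : ∀ η i, Integrable (fun z => ‖z i‖ ^ 2) (l η) ∧
      ∫ z, ‖z i‖ ^ 2 ∂(l η) ≤ (cXi c η (Pi.single i 1) (Pi.single i 1)).re) (m n : Fin d → ℕ) :
    Integrable (fun z => cmom z m n) (l (single 0 1)) ∧
      c m n = ∫ z, cmom z m n ∂(l (single 0 1)) := by
  obtain ⟨τ, hτ, hac⟩ : ∃ τ : Measure (Fin d → ℂ), IsFiniteMeasure τ ∧
      ∀ k : Fin d → ℕ, l (single k 1) ≪ τ :=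
    ⟨(Measure.sum fun k : Fin d → ℕ => l (single k 1)).toFinite, inferInstance, fun k =>
      (Measure.absolutelyContinuous_sum_right k Measure.AbsolutelyContinuous.rfl).trans
        (absolutelyContinuous_toFinite _)⟩
  have hLD : ∀ k : Fin d → ℕ, (l (single k 1)).HaveLebesgueDecomposition τ := fun k =>
    Measure.haveLebesgueDecomposition_of_sigmaFinite _ _
  have hb : ∀ x : (Fin d → ℕ) →₀ ℂ, ∃ C : ℝ, ∀ t : ℝ, |t| ≤ 1 →
      (l ((t : ℂ) • x)).real Set.univ ≤ C := by
    intro x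
    refine ⟨(l x).real Set.univ, fun t ht => ?_⟩
    have h := h00 ((t : ℂ) • x)
    rw [cXi_smul, ← h00, normSq_ofReal] at h
    have h' : (l ((t : ℂ) • x)).real Set.univ = t * t * (l x).real Set.univ := by exact_mod_cast h
    rw [h', ← abs_mul_abs_self t]
    have : |t| * |t| ≤ 1 := mul_le_one₀ ht (abs_nonneg t) ht
    exact mul_le_of_le_one_left measureReal_nonneg this
  let κ : (Fin d → ℂ) → (Fin d → ℕ) → (Fin d → ℕ) → ℂ := fun z k k' =>
    kernelDensity l τ (single k 1) (single k' 1) z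
  have hmom : ∀ (f : (Fin d → ℂ) → ℂ) (m n : Fin d → ℕ),
      (∀ η, Integrable f (l η) ∧ ∫ z, f z ∂(l η) = cXi c η m n) → ∀ k k',
      Integrable (fun z => f z * κ z k k') τ ∧ ∫ z, f z * κ z k k' ∂τ = c (m + k) (n + k') := by
    intro f m n hf k k'
    obtain ⟨h1, h2⟩ := kernelDensity_integral hpar hI (hac k) (hac k') fun x => (hf x).1
    refine ⟨h1, h2.trans ?_⟩
    rw [(hf _).2, (hf _).2, (hf _).2, (hf _).2, cXi_polarization, cForm_single]
    simp
  have hκ : ∀ k k', Integrable (fun z => κ z k k') τ ∧ ∫ z, κ z k k' ∂τ = c k k' := by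
    intro k k'
    simpa using hmom (fun _ => 1) 0 0 (fun η => ⟨integrable_const 1, by simp [← h00]⟩) k k'
  have herm : ∀ᵐ z ∂τ, ∀ k k', (starRingEnd ℂ) (κ z k k') = κ z k' k :=
    ae_all_iff.2 fun k => ae_all_iff.2 fun k' => kernelDensity_conj hpar hI (hac k) (hac k')
  have hdiag : ∀ᵐ z ∂τ, ∀ k, κ z k k = ((l (single k 1)).rnDeriv τ z).toReal :=
    ae_all_iff.2 fun k => kernelDensity_self hpar hI (hac k)
  have hpsd : ∀ᵐ z ∂τ, ∀ (x : Fin 3 → Fin d → ℕ) (s : Fin 3 → ℂ),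
      0 ≤ (∑ i, ∑ j, s i * (starRingEnd ℂ) (s j) * κ z (x i) (x j)).re :=
    ae_all_iff.2 fun x => kernelDensity_nonneg hpar hI hb fun i => hac (x i)
  have hnull : ∀ᵐ z ∂τ, ∀ (i : Fin d) (k : Fin d → ℕ),
      (κ z (Pi.single i 1 + k) (Pi.single i 1 + k)).re
        - 2 * (z i * κ z k (Pi.single i 1 + k)).re + ‖z i‖ ^ 2 * (κ z k k).re = 0 := by
    refine ae_all_iff.2 fun i => ae_all_iff.2 fun k => ?_
    set a : Fin d → ℕ := Pi.single i 1 + k with ha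
    have i1 : Integrable (fun z => (κ z a a).re) τ := (hκ a a).1.re
    obtain ⟨i2, e2⟩ := hmom (fun z => z i) (Pi.single i 1) 0 (fun η => h10 η i) k a
    rw [zero_add, ← ha] at e2
    have i2' : Integrable (fun z => 2 * (z i * κ z k a).re) τ := i2.re.const_mul 2
    have i3 : Integrable (fun z => ((l (single k 1)).rnDeriv τ z).toReal * ‖z i‖ ^ 2) τ :=
      (integrable_rnDeriv_smul_iff (hac k)).2 (h11 _ i).1
    have e3 : ∫ z, ((l (single k 1)).rnDeriv τ z).toReal * ‖z i‖ ^ 2 ∂τ ≤ (c a a).re := by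
      refine (integral_toReal_rnDeriv_mul (hac k)).trans_le ((h11 _ i).2.trans_eq ?_)
      rw [cXi_eq_cForm, cForm_single]
      simp [ha]
    have i3' : Integrable (fun z => ‖z i‖ ^ 2 * (κ z k k).re) τ := by
      refine i3.congr ?_
      filter_upwards [hdiag] with z hz
      rw [hz, ofReal_re, mul_comm]
    have e3' : ∫ z, ‖z i‖ ^ 2 * (κ z k k).re ∂τ ≤ (c a a).re := by
      refine (integral_congr_ae ?_).trans_le e3
      filter_upwards [hdiag] with z hz
      rw [hz, ofReal_re, mul_comm]
    have e1 : ∫ z, (κ z a a).re ∂τ = (c a a).re := by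
      rw [← (hκ a a).2]; exact integral_re (hκ a a).1
    have e2' : ∫ z, (z i * κ z k a).re ∂τ = (c a a).re := by
      rw [← e2]; exact integral_re i2
    have j1 : Integrable (fun z => (κ z a a).re - 2 * (z i * κ z k a).re) τ :=
      i1.sub i2'
    have hnn : 0 ≤ᵐ[τ] fun z =>
        (κ z a a).re - 2 * (z i * κ z k a).re + ‖z i‖ ^ 2 * (κ z k k).re := by
      filter_upwards [herm, hpsd] with z hz hp
      have h := hp ![a, k, k] ![1, -z i, 0]
      simp only [Fin.sum_univ_three, Matrix.cons_val_zero, Matrix.cons_val_one, Matrix.cons_val]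
        at h
      rw [← hz k a] at h
      have him : (κ z k k).im = 0 := by
        have := congrArg Complex.im (hz k k)
        simp at this
        linarith
      simp only [Pi.zero_apply]
      rw [← normSq_eq_norm_sq]
      simp only [normSq_apply, map_neg, map_one, map_zero, add_re, mul_re, mul_im, neg_re,
        neg_im, conj_re, conj_im, one_re, one_im, him, zero_re, zero_im] at h ⊢
      linarith
    refine (integral_eq_zero_iff_of_nonneg_ae hnn (j1.add i3')).1 (le_antisymm ?_
      (integral_nonneg_of_ae hnn))
    rw [integral_add j1 i3', integral_sub i1 i2', integral_const_mul, e1, e2']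
    linarith
  have hfinal : (fun z => κ z m n) =ᵐ[τ] fun z =>
      ((l (single 0 1)).rnDeriv τ z).toReal • cmom z m n := by
    filter_upwards [herm, hdiag, hpsd, hnull] with z h1 h2 h3 h4
    rw [kernel_eq_cmom z h1 (fun i k k' => kernel_eq_mul_of_null h1 h3 _ _ _ _ (h4 i k)) m n, h2,
      real_smul, mul_comm]
  refine ⟨(integrable_rnDeriv_smul_iff (hac 0)).1 ((hκ m n).1.congr hfinal), ?_⟩
  rw [← (hκ m n).2, integral_congr_ae hfinal, integral_rnDeriv_smul (hac 0)]

/-- The analytic polynomial on `ℂ^d` with coefficients `ξ`. -/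
def coeffPoly {d : ℕ} (ξ : (Fin d → ℕ) →₀ ℂ) (z : Fin d → ℂ) : ℂ :=
  linearCombination ℂ (fun k : Fin d → ℕ => ∏ i, z i ^ k i) ξ

theorem measurable_coeffPoly {d : ℕ} (ξ : (Fin d → ℕ) →₀ ℂ) : Measurable (coeffPoly ξ) := by
  unfold coeffPoly
  simp only [linearCombination_apply, Finsupp.sum, smul_eq_mul]
  fun_prop

theorem cmom_mul_normSq_coeffPoly {d : ℕ} (ξ : (Fin d → ℕ) →₀ ℂ) (z : Fin d → ℂ)
    (m n : Fin d → ℕ) :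
    normSq (coeffPoly ξ z) • cmom z m n = ∑ k ∈ ξ.support, ∑ l ∈ ξ.support,
      cmom z (m + k) (n + l) * ξ k * (starRingEnd ℂ) (ξ l) := by
  rw [real_smul, ← mul_conj, coeffPoly, linearCombination_apply, Finsupp.sum, map_sum,
    Finset.sum_mul_sum, Finset.sum_mul]
  refine Finset.sum_congr rfl fun k _ => ?_
  rw [Finset.sum_mul]
  refine Finset.sum_congr rfl fun l _ => ?_
  simp only [cmom, Pi.add_apply, pow_add, Finset.prod_mul_distrib, smul_eq_mul, map_mul, map_prod,
    map_pow]
  ring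

theorem exists_truncated_family {d : ℕ} {c : (Fin d → ℕ) → (Fin d → ℕ) → ℂ}
    {ν : Measure (Fin d → ℂ)} (hν : ∀ m n : Fin d → ℕ,
      Integrable (fun z => cmom z m n) ν ∧ c m n = ∫ z, cmom z m n ∂ν) :
    ∃ μ : ((Fin d → ℕ) →₀ ℂ) → Measure (Fin d → ℂ),
      (∀ ξ m n, Integrable (fun z => cmom z m n) (μ ξ) ∧
        cXi c ξ m n = ∫ z, cmom z m n ∂(μ ξ)) ∧
      μ 0 = 0 ∧
      ∀ ξ η : (Fin d → ℕ) →₀ ℂ, ∀ σ : Set (Fin d → ℂ), MeasurableSet σ →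
        2 * μ η σ ≤ μ (ξ + η) σ + μ (ξ - η) σ := by
  have hmeas : ∀ ξ : (Fin d → ℕ) →₀ ℂ,
      Measurable fun z => ENNReal.ofReal (normSq (coeffPoly ξ z)) := fun ξ =>
    ENNReal.measurable_ofReal.comp
      (continuous_normSq.measurable.comp (measurable_coeffPoly ξ))
  refine ⟨fun ξ => ν.withDensity fun z => ENNReal.ofReal (normSq (coeffPoly ξ z)),
    fun ξ m n => ?_, ?_, fun ξ η σ hσ => ?_⟩
  · have hlt : ∀ᵐ z ∂ν, ENNReal.ofReal (normSq (coeffPoly ξ z)) < ⊤ :=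
      ae_of_all _ fun z => ENNReal.ofReal_lt_top
    have hterm : ∀ k l : Fin d → ℕ, Integrable
        (fun z => cmom z (m + k) (n + l) * ξ k * (starRingEnd ℂ) (ξ l)) ν := fun k l =>
      ((hν _ _).1.mul_const _).mul_const _
    rw [integrable_withDensity_iff_integrable_smul' (hmeas ξ) hlt,
      integral_withDensity_eq_integral_toReal_smul (hmeas ξ) hlt]
    simp only [ENNReal.toReal_ofReal (normSq_nonneg _), cmom_mul_normSq_coeffPoly]
    refine ⟨integrable_finsetSum _ fun k _ => integrable_finsetSum _ fun l _ => hterm k l, ?_⟩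
    rw [integral_finsetSum _ fun k _ => integrable_finsetSum _ fun l _ => hterm k l, cXi]
    refine Finset.sum_congr rfl fun k _ => ?_
    rw [integral_finsetSum _ fun l _ => hterm k l]
    refine Finset.sum_congr rfl fun l _ => ?_
    rw [integral_mul_const, integral_mul_const, (hν _ _).2]
  · simp [coeffPoly]
  · simp only [withDensity_apply _ hσ]
    rw [← lintegral_const_mul _ (hmeas η), ← lintegral_add_left (hmeas _)]
    refine lintegral_mono fun z => ?_
    rw [← ENNReal.ofReal_add (normSq_nonneg _) (normSq_nonneg _),
      ← ENNReal.ofReal_ofNat, ← ENNReal.ofReal_mul zero_le_two]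
    refine ENNReal.ofReal_le_ofReal ?_
    simp only [coeffPoly, map_add, map_sub]
    rw [normSq_add, normSq_sub]
    linarith [normSq_nonneg (linearCombination ℂ (fun k : Fin d → ℕ => ∏ i, z i ^ k i) ξ)]

/-- A `2d`-multisequence is a complex moment multisequence iff there is a family of positive
Borel measures on `ℂ^d` solving the truncations with `m, n ∈ N₁` and satisfying
`μ_0 = 0`, `μ_{ξ+η} + μ_{ξ-η} - 2μ_η ≥ 0`. -/
theorem complexMoment_iff_truncated_family (d : ℕ) (hd : 1 ≤ d)
    (c : (Fin d → ℕ) → (Fin d → ℕ) → ℂ) :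
    (∃ ν : Measure (Fin d → ℂ), ∀ m n : Fin d → ℕ,
        Integrable (fun z => cmom z m n) ν ∧ c m n = ∫ z, cmom z m n ∂ν) ↔
    (∃ μ : ((Fin d → ℕ) →₀ ℂ) → Measure (Fin d → ℂ),
        (∀ ξ : (Fin d → ℕ) →₀ ℂ, ∀ m n : Fin d → ℕ, (∑ i, m i ≤ 1) → (∑ i, n i ≤ 1) →
            Integrable (fun z => cmom z m n) (μ ξ) ∧ cXi c ξ m n = ∫ z, cmom z m n ∂(μ ξ)) ∧
        μ 0 = 0 ∧
        (∀ ξ η : (Fin d → ℕ) →₀ ℂ, ∀ σ : Set (Fin d → ℂ), MeasurableSet σ →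
            2 * μ η σ ≤ μ (ξ + η) σ + μ (ξ - η) σ)) := by
  constructor
  · rintro ⟨ν, hν⟩
    obtain ⟨μ, h1, h2, h3⟩ := exists_truncated_family hν
    exact ⟨μ, fun ξ m n _ _ => h1 ξ m n, h2, h3⟩
  · rintro ⟨μ, h1, -, h3⟩
    obtain ⟨l, hfin, hpar, hI, h00, h10, h11⟩ := exists_quadratic_family c μ h1 h3
    exact ⟨l (single 0 1), moment_of_quadratic_family c l hpar hI h00 h10 h11⟩
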